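/- arXiv:1910.12567 — 2 statements merged into one kernel-verified Lean document; each statement's English description precedes it below -/
import Mathlib

section
/- For a prime p, the zero-divisor graph Γ(ℤ_p × ℤ_p × ℤ_p) has exactly 6 nonzero eigenvalues, which are (1/2)(1−p ± (p−1)√(4p−3)) each with multiplicity 2, and (p−1) ± √(p − 2p² + p³) each with multiplicity 1; the eigenvalue 0 has multiplicity 3(p+1)(p−2). -/
open Polynomial in
/-- A matrix pulled back along a map of index types has, up to powers of `X`, the characteristic
polynomial of the original matrix weighted by the sizes of the fibres. -/
theorem charpoly_submatrix_self {V K R : Type*} [Fintype V] [DecidableEq V] [Fintype K]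
    [DecidableEq K] [CommRing R] (f : V → K) (M : Matrix K K R) (n : K → R)
    (hn : ∀ k, ((Finset.univ.filter fun x => f x = k).card : R) = n k) :
    X ^ Fintype.card K * (M.submatrix f f).charpoly =
      X ^ Fintype.card V * (M * Matrix.diagonal n).charpoly := by
  let U : Matrix V K R := (1 : Matrix K K R).submatrix f id
  have hA : M.submatrix f f = U * (M * U.transpose) := by
    ext x y
    simp [U, Matrix.mul_apply, Matrix.one_apply]
  have hD : U.transpose * U = Matrix.diagonal n := by
    ext k l
    rw [Matrix.mul_apply, Matrix.diagonal_apply, ← hn, Finset.card_filter]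
    simp only [U, Matrix.transpose_apply, Matrix.submatrix_apply, Matrix.one_apply, id]
    push_cast
    split_ifs with h
    · subst h; simp [← ite_and]
    · refine Finset.sum_eq_zero fun x _ => ?_
      by_cases h' : f x = k <;> simp_all
  rw [hA, Matrix.charpoly_mul_comm', Matrix.mul_assoc, hD]

/-- Disjointness of supports for the six nonempty proper subsets of a three-element set: the
indices `0, 1, 2` are the pairs, and `3, 4, 5` are their complementary singletons. -/
def disjointSupportMatrix : Matrix (Fin 6) (Fin 6) ℝ :=
  !![0, 0, 0, 1, 0, 0;
     0, 0, 0, 0, 1, 0;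
     0, 0, 0, 0, 0, 1;
     1, 0, 0, 0, 1, 1;
     0, 1, 0, 1, 0, 1;
     0, 0, 1, 1, 1, 0]

/-- The number of elements of each support type, with `q` nonzero choices per coordinate. -/
def supportTypeCount {R : Type*} [Monoid R] (q : R) : Fin 6 → R :=
  ![q ^ 2, q ^ 2, q ^ 2, q, q, q]

/-- The index in `disjointSupportMatrix` of the support of `x` (junk for `0` and for units). -/
def supportType {F : Type*} [Zero F] [DecidableEq F] (x : F × F × F) : Fin 6 :=
  if x.1 = 0 then if x.2.1 = 0 then 5 else if x.2.2 = 0 then 4 else 0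
  else if x.2.1 = 0 then if x.2.2 = 0 then 3 else 1 else 2

open Polynomial in
theorem charpoly_disjointSupportMatrix_mul (q : ℝ) :
    (disjointSupportMatrix * Matrix.diagonal (supportTypeCount q)).charpoly =
      (X ^ 2 - C (2 * q) * X - C (q ^ 3)) * (X ^ 2 + C q * X - C (q ^ 3)) ^ 2 := by
  have h : disjointSupportMatrix * Matrix.diagonal (supportTypeCount q) =
      !![0, 0, 0, q, 0, 0;
         0, 0, 0, 0, q, 0;
         0, 0, 0, 0, 0, q;
         q ^ 2, 0, 0, 0, q, q;
         0, q ^ 2, 0, q, 0, q;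
         0, 0, q ^ 2, q, q, 0] := by
    ext i j
    rw [Matrix.mul_diagonal]
    fin_cases i <;> fin_cases j <;> simp [disjointSupportMatrix, supportTypeCount]
  have h' : Matrix.charmatrix (disjointSupportMatrix * Matrix.diagonal (supportTypeCount q)) =
      !![X, 0, 0, -C q, 0, 0;
         0, X, 0, 0, -C q, 0;
         0, 0, X, 0, 0, -C q;
         -C q ^ 2, 0, 0, X, -C q, -C q;
         0, -C q ^ 2, 0, -C q, X, -C q;
         0, 0, -C q ^ 2, -C q, -C q, X] := by
    rw [h]
    ext1 i j
    fin_cases i <;> fin_cases j <;> simp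
  rw [Matrix.charpoly, h']
  simp [Matrix.det_succ_row_zero, Fin.sum_univ_succ, Fin.succAbove, map_ofNat]
  ring

theorem exists_ne_zero_mul_eq_zero_iff {F : Type*} [Field F] (x : F × F × F) :
    (x ≠ 0 ∧ ∃ y, y ≠ 0 ∧ x * y = 0) ↔
      ¬(x.1 = 0 ∧ x.2.1 = 0 ∧ x.2.2 = 0) ∧ (x.1 = 0 ∨ x.2.1 = 0 ∨ x.2.2 = 0) := by
  obtain ⟨a, b, c⟩ := x
  refine and_congr (by simp [Prod.ext_iff]) ⟨?_, ?_⟩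
  · rintro ⟨⟨u, v, w⟩, hy, h⟩
    simp only [Prod.ext_iff, Prod.fst_mul, Prod.snd_mul, Prod.fst_zero, Prod.snd_zero,
      mul_eq_zero, ne_eq] at hy h
    tauto
  · rintro (h | h | h)
    · exact ⟨(1, 0, 0), by simp [Prod.ext_iff], by simp_all [Prod.ext_iff]⟩
    · exact ⟨(0, 1, 0), by simp [Prod.ext_iff], by simp_all [Prod.ext_iff]⟩
    · exact ⟨(0, 0, 1), by simp [Prod.ext_iff], by simp_all [Prod.ext_iff]⟩

theorem card_supportType_eq {F : Type*} [Field F] [Fintype F] [DecidableEq F]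
    [Fintype {x : F × F × F // x ≠ 0 ∧ ∃ y, y ≠ 0 ∧ x * y = 0}] (k : Fin 6) :
    (Finset.univ.filter fun x : {x : F × F × F // x ≠ 0 ∧ ∃ y, y ≠ 0 ∧ x * y = 0} =>
      supportType x.1 = k).card = supportTypeCount (Fintype.card F - 1) k := by
  let Z : Finset F := {0}
  let N : Finset F := {0}ᶜ
  let S : Fin 6 → Finset (F × F × F) :=
    ![Z ×ˢ N ×ˢ N, N ×ˢ Z ×ˢ N, N ×ˢ N ×ˢ Z, N ×ˢ Z ×ˢ Z, Z ×ˢ N ×ˢ Z, Z ×ˢ Z ×ˢ N]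
  have hS : (Finset.univ.filter fun x : {x : F × F × F // x ≠ 0 ∧ ∃ y, y ≠ 0 ∧ x * y = 0} =>
      supportType x.1 = k).map (Function.Embedding.subtype _) = S k := by
    ext x
    simp only [Finset.mem_map, Finset.mem_filter, Finset.mem_univ, true_and,
      Function.Embedding.subtype_apply, Subtype.exists, exists_and_right, exists_prop,
      exists_ne_zero_mul_eq_zero_iff]
    obtain ⟨a, b, c⟩ := x
    by_cases ha : a = 0 <;> by_cases hb : b = 0 <;> by_cases hc : c = 0 <;> fin_cases k <;>
      simp [S, Z, N, supportType, ha, hb, hc, @eq_comm F 0]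
  rw [← Finset.card_map, hS]
  fin_cases k <;>
    simp [S, Z, N, supportTypeCount, Finset.card_product, Finset.card_compl, pow_two]

theorem ite_mul_eq_zero_eq_disjointSupportMatrix {F : Type*} [Field F] [DecidableEq F]
    {x y : F × F × F} (hx : x ≠ 0 ∧ ∃ y, y ≠ 0 ∧ x * y = 0)
    (hy : y ≠ 0 ∧ ∃ z, z ≠ 0 ∧ y * z = 0) [Decidable (x * y = 0)] :
    (if x * y = 0 then 1 else 0) = disjointSupportMatrix (supportType x) (supportType y) := by
  rw [exists_ne_zero_mul_eq_zero_iff] at hx hy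
  obtain ⟨a, b, c⟩ := x
  obtain ⟨u, v, w⟩ := y
  have h : (a, b, c) * (u, v, w) = 0 ↔ (a = 0 ∨ u = 0) ∧ (b = 0 ∨ v = 0) ∧ (c = 0 ∨ w = 0) := by
    simp [Prod.ext_iff]
  simp only [h]
  by_cases ha : a = 0 <;> by_cases hb : b = 0 <;> by_cases hc : c = 0 <;>
    by_cases hu : u = 0 <;> by_cases hv : v = 0 <;> by_cases hw : w = 0 <;>
    first
      | (exfalso; simp [ha, hb, hc, hu, hv, hw] at hx hy; done)
      | simp [supportType, disjointSupportMatrix, ha, hb, hc, hu, hv, hw]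

open Polynomial in
theorem charpoly_zeroDivisorMatrix {F : Type*} [Field F] [Fintype F] [DecidableEq F]
    [Fintype {x : F × F × F // x ≠ 0 ∧ ∃ y, y ≠ 0 ∧ x * y = 0}]
    [DecidableEq {x : F × F × F // x ≠ 0 ∧ ∃ y, y ≠ 0 ∧ x * y = 0}]
    (A : Matrix {x : F × F × F // x ≠ 0 ∧ ∃ y, y ≠ 0 ∧ x * y = 0}
      {x : F × F × F // x ≠ 0 ∧ ∃ y, y ≠ 0 ∧ x * y = 0} ℝ)
    (hA : ∀ x y, A x y = disjointSupportMatrix (supportType x.1) (supportType y.1))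
    (q : ℝ) (hq : q = Fintype.card F - 1) :
    A.charpoly = X ^ (3 * (Fintype.card F + 1) * (Fintype.card F - 2)) *
      ((X ^ 2 - C (2 * q) * X - C (q ^ 3)) * (X ^ 2 + C q * X - C (q ^ 3)) ^ 2) := by
  obtain ⟨m, hm⟩ := Nat.exists_eq_add_of_le' (Fintype.one_lt_card (α := F))
  replace hm : Fintype.card F = m + 2 := hm
  have hqm : ((m + 1 : ℕ) : ℝ) = q := by rw [hq, hm]; push_cast; ring
  have hcard : Fintype.card {x : F × F × F // x ≠ 0 ∧ ∃ y, y ≠ 0 ∧ x * y = 0} =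
      6 + 3 * (Fintype.card F + 1) * (Fintype.card F - 2) := by
    rw [← Finset.card_univ, Finset.card_eq_sum_card_fiberwise
      (f := fun x => supportType x.1) (t := Finset.univ) (by simp)]
    simp only [card_supportType_eq, hm, supportTypeCount, Fin.sum_univ_succ]
    simp
    ring
  have h := (charpoly_submatrix_self
    (fun x : {x : F × F × F // x ≠ 0 ∧ ∃ y, y ≠ 0 ∧ x * y = 0} => supportType x.1)
    disjointSupportMatrix (supportTypeCount q) (fun k => by
      rw [card_supportType_eq, hm, ← hqm]
      fin_cases k <;> simp [supportTypeCount])).trans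
    (congrArg _ (charpoly_disjointSupportMatrix_mul q))
  rw [hcard, Fintype.card_fin, pow_add, mul_assoc] at h
  rw [show A = disjointSupportMatrix.submatrix _ _ from Matrix.ext hA]
  exact mul_left_cancel₀ (pow_ne_zero 6 X_ne_zero) h

open Polynomial in
/-- The spectrum of `Γ(ℤ_p × ℤ_p × ℤ_p)`: the nonzero eigenvalues are
`(1/2)(1−p ± (p−1)√(4p−3))` with multiplicity 2 each and `(p−1) ± √(p−2p²+p³)` with
multiplicity 1 each (6 nonzero eigenvalues in total), and the eigenvalue 0 has
multiplicity `3(p+1)(p−2)`. -/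
theorem stmt12 (p : ℕ) [Fact p.Prime] :
    let R := ZMod p × ZMod p × ZMod p
    let V := {x : R // x ≠ 0 ∧ ∃ y, y ≠ 0 ∧ x * y = 0}
    let A : Matrix V V ℝ := fun x y => if x.1 * y.1 = 0 then 1 else 0
    let P : ℝ := (p : ℝ)
    A.charpoly.rootMultiplicity ((1 - P + (P - 1) * Real.sqrt (4 * P - 3)) / 2) = 2 ∧
    A.charpoly.rootMultiplicity ((1 - P - (P - 1) * Real.sqrt (4 * P - 3)) / 2) = 2 ∧
    A.charpoly.rootMultiplicity (P - 1 + Real.sqrt (P - 2 * P ^ 2 + P ^ 3)) = 1 ∧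
    A.charpoly.rootMultiplicity (P - 1 - Real.sqrt (P - 2 * P ^ 2 + P ^ 3)) = 1 ∧
    A.charpoly.rootMultiplicity 0 = 3 * (p + 1) * (p - 2) ∧
    Multiset.card (A.charpoly.roots.filter fun x => x ≠ 0) = 6 := by
  intro R V A P
  have hP : 1 < P := Nat.one_lt_cast.mpr (Fact.out : p.Prime).one_lt
  have hchar := charpoly_zeroDivisorMatrix A
    (fun x y => ite_mul_eq_zero_eq_disjointSupportMatrix x.2 y.2) (P - 1) (by rw [ZMod.card])
  rw [ZMod.card] at hchar
  have hs := Real.sq_sqrt (show 0 ≤ 4 * P - 3 by linarith)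
  have hs0 := Real.sqrt_pos.mpr (show 0 < 4 * P - 3 by linarith)
  have ht0 : 0 < P - 2 * P ^ 2 + P ^ 3 := by
    have : 0 < P * (P - 1) ^ 2 := by have := sub_pos.mpr hP; positivity
    linarith
  have ht := Real.sq_sqrt ht0.le
  replace ht0 := Real.sqrt_pos.mpr ht0
  set s := Real.sqrt (4 * P - 3)
  set t := Real.sqrt (P - 2 * P ^ 2 + P ^ 3)
  set a := (1 - P + (P - 1) * s) / 2 with ha
  set b := (1 - P - (P - 1) * s) / 2 with hb
  set c := P - 1 + t with hc
  set d := P - 1 - t with hd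
  have hab : a + b = -(P - 1) := by rw [ha, hb]; ring
  have hab' : a * b = -(P - 1) ^ 3 := by
    rw [ha, hb]; linear_combination (-(P - 1) ^ 2 / 4) * hs
  have hcd : c + d = 2 * (P - 1) := by rw [hc, hd]; ring
  have hcd' : c * d = -(P - 1) ^ 3 := by rw [hc, hd]; linear_combination -ht
  have hq3 : 0 < (P - 1) ^ 3 := pow_pos (sub_pos.mpr hP) 3
  have hba : b ≠ a := by
    have := mul_pos (sub_pos.mpr hP) hs0
    exact ne_of_lt (by rw [ha, hb]; linarith)
  have hdc : d ≠ c := ne_of_lt (by rw [hc, hd]; linarith)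
  have ha0 : a ≠ 0 := by rintro h; rw [h] at hab'; linarith
  have hb0 : b ≠ 0 := by rintro h; rw [h] at hab'; linarith
  have hc0 : c ≠ 0 := by rintro h; rw [h] at hcd'; linarith
  have hd0 : d ≠ 0 := by rintro h; rw [h] at hcd'; linarith
  -- a common root `x` of the two quadratics would satisfy `3 (P - 1) x = 0`
  have key : ∀ x, (x - a) * (x - b) = 0 → (x - c) * (x - d) = 0 → x = 0 := fun x h1 h2 => by
    have : (P - 1) * x = 0 := by
      linear_combination (h1 - h2 + x * hab - x * hcd - hab' + hcd') / 3
    exact (mul_eq_zero.mp this).resolve_left (sub_pos.mpr hP).ne'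
  have hac : a ≠ c := fun h => ha0 (key a (by simp) (by simp [h]))
  have had : a ≠ d := fun h => ha0 (key a (by simp) (by simp [h]))
  have hbc : b ≠ c := fun h => hb0 (key b (by simp) (by simp [h]))
  have hbd : b ≠ d := fun h => hb0 (key b (by simp) (by simp [h]))
  have hquad : ∀ u v m n : ℝ, u + v = m → u * v = n →
      (X ^ 2 - C m * X + C n : ℝ[X]) = (X - C u) * (X - C v) := by
    rintro u v _ _ rfl rfl
    simp only [C_add, C_mul]
    ring
  have hroots : A.charpoly.roots =
      Multiset.replicate (3 * (p + 1) * (p - 2)) 0 + {c, d, a, a, b, b} := by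
    rw [hchar, ← roots_multiset_prod_X_sub_C (_ + _)]
    congr 1
    have h1 := hquad a b _ _ hab hab'
    have h2 := hquad c d _ _ hcd hcd'
    simp only [C_neg, ← sub_eq_add_neg, neg_mul, sub_neg_eq_add] at h1 h2
    rw [h1, h2]
    simp
    ring
  simp only [← count_roots, hroots]
  refine ⟨?_, ?_, ?_, ?_, ?_, ?_⟩
  all_goals
    simp [Multiset.filter_singleton, Multiset.filter_eq_nil, Multiset.mem_replicate,
      Multiset.insert_eq_cons, ha0, hb0, hc0,
      hd0, ha0.symm, hb0.symm, hc0.symm, hd0.symm, hac, hac.symm, had, had.symm, hbc, hbc.symm,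
      hbd, hbd.symm, hba, hba.symm, hdc, hdc.symm]
end

section
/- For primes p ≠ q, the characteristic polynomial of the zero-divisor graph Γ(ℤ_{p²} × ℤ_p) restricted to its nonzero spectrum, i.e. the characteristic polynomial of the weighted compressed adjacency matrix, equals (p−1)⁵p + (p−1)³p·x − 2(p−1)²p·x² − (p−1)x³ + x⁴; in particular Γ(ℤ_{p²} × ℤ_p) has exactly 4 nonzero eigenvalues counted with multiplicity. -/
/-- Two ring elements are equivalent iff they have the same annihilator. -/
def annSetoid (R : Type*) [CommRing R] : Setoid R :=
  ⟨fun r s => ∀ x, x * r = 0 ↔ x * s = 0,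
   fun _ _ => Iff.rfl, fun h x => (h x).symm, fun h1 h2 x => (h1 x).trans (h2 x)⟩

/-- Characteristic polynomial of a matrix indexed by a finite type, with classically
chosen `Fintype`/`DecidableEq` instances. -/
noncomputable def qcharpoly {Q : Type*} [Finite Q] (M : Matrix Q Q ℝ) : Polynomial ℝ :=
  letI := Classical.decEq Q
  letI := Fintype.ofFinite Q
  M.charpoly

/-- The valuation on `ZMod (p ^ 2)`, truncated at `2`. -/
noncomputable def truncVal {R : Type*} [CommRing R] (x : R) : ℕ :=
  open Classical in if x = 0 then 2 else if IsUnit x then 0 else 1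

/-- The indicator of zero. -/
noncomputable def zeroInd {R : Type*} [CommRing R] (x : R) : ℕ :=
  open Classical in if x = 0 then 1 else 0

section

variable {p : ℕ} [Fact p.Prime]

theorem ZMod.exists_eq_mul_of_not_isUnit {x : ZMod (p ^ 2)} (hx : ¬ IsUnit x) :
    ∃ a, x = (p : ZMod (p ^ 2)) * a := by
  have hp : p.Prime := Fact.out
  rw [← ZMod.natCast_zmod_val x, ZMod.isUnit_iff_coprime,
    Nat.coprime_pow_right_iff (by norm_num), Nat.coprime_comm, hp.coprime_iff_not_dvd,
    not_not] at hx
  obtain ⟨a, ha⟩ := hx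
  exact ⟨a, by rw [← Nat.cast_mul, ← ha, ZMod.natCast_zmod_val]⟩

theorem ZMod.mul_eq_zero_iff_truncVal (x y : ZMod (p ^ 2)) :
    x * y = 0 ↔ 2 ≤ truncVal x + truncVal y := by
  unfold truncVal
  by_cases hx : x = 0
  · simp [hx]
  by_cases hy : y = 0
  · simp [hy]
  by_cases ux : IsUnit x
  · simp only [ux.mul_right_eq_zero, hx, hy, ux, if_true, if_false]
    split_ifs <;> simp
  by_cases uy : IsUnit y
  · simp [uy.mul_left_eq_zero, hx, hy, ux, uy]
  obtain ⟨a, rfl⟩ := exists_eq_mul_of_not_isUnit ux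
  obtain ⟨b, rfl⟩ := exists_eq_mul_of_not_isUnit uy
  have h : (p : ZMod (p ^ 2)) ^ 2 = 0 := by exact_mod_cast ZMod.natCast_self (p ^ 2)
  simp only [hx, hy, ux, uy, if_false, le_refl, iff_true]
  linear_combination a * b * h

theorem ZMod.mul_eq_zero_iff_zeroInd (x y : ZMod p) :
    x * y = 0 ↔ 1 ≤ zeroInd x + zeroInd y := by
  unfold zeroInd
  rw [mul_eq_zero]
  split_ifs <;> simp_all

theorem prod_mul_eq_zero_iff (x y : ZMod (p ^ 2) × ZMod p) :
    x * y = 0 ↔ 2 ≤ truncVal x.1 + truncVal y.1 ∧ 1 ≤ zeroInd x.2 + zeroInd y.2 := by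
  rw [← ZMod.mul_eq_zero_iff_truncVal, ← ZMod.mul_eq_zero_iff_zeroInd, Prod.ext_iff]
  rfl

instance : Fact (1 < p ^ 2) :=
  ⟨Nat.one_lt_pow two_ne_zero (Fact.out : p.Prime).one_lt⟩

theorem truncVal_zero {R : Type*} [CommRing R] : truncVal (0 : R) = 2 := by simp [truncVal]

theorem truncVal_one {R : Type*} [CommRing R] [Nontrivial R] : truncVal (1 : R) = 0 := by
  simp [truncVal]

theorem truncVal_prime : truncVal (p : ZMod (p ^ 2)) = 1 := by
  have hp : p.Prime := Fact.out
  have h0 : (p : ZMod (p ^ 2)) ≠ 0 := by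
    rw [Ne, ZMod.natCast_eq_zero_iff]
    intro h
    have := Nat.le_of_dvd hp.pos h
    nlinarith [hp.one_lt]
  have h1 : ¬ IsUnit (p : ZMod (p ^ 2)) := by
    rw [ZMod.isUnit_iff_coprime, Nat.coprime_pow_right_iff (by norm_num), Nat.coprime_self]
    exact hp.one_lt.ne'
  simp [truncVal, h0, h1]

theorem truncVal_le {R : Type*} [CommRing R] (x : R) : truncVal x ≤ 2 := by
  unfold truncVal
  split_ifs <;> simp

theorem truncVal_eq_two {R : Type*} [CommRing R] {x : R} : truncVal x = 2 ↔ x = 0 := by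
  unfold truncVal
  split_ifs <;> simp_all

theorem truncVal_eq_zero {R : Type*} [CommRing R] [Nontrivial R] {x : R} :
    truncVal x = 0 ↔ IsUnit x := by
  unfold truncVal
  split_ifs <;> simp_all

theorem zeroInd_zero {R : Type*} [CommRing R] : zeroInd (0 : R) = 1 := by simp [zeroInd]

theorem zeroInd_one {R : Type*} [CommRing R] [Nontrivial R] : zeroInd (1 : R) = 0 := by
  simp [zeroInd]

theorem zeroInd_le {R : Type*} [CommRing R] (x : R) : zeroInd x ≤ 1 := by
  unfold zeroInd
  split_ifs <;> simp

theorem zeroInd_eq_one {R : Type*} [CommRing R] {x : R} : zeroInd x = 1 ↔ x = 0 := by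
  unfold zeroInd
  split_ifs <;> simp_all

theorem annSetoid_rel_iff (r s : ZMod (p ^ 2) × ZMod p) :
    (annSetoid (ZMod (p ^ 2) × ZMod p)).r r s ↔
      truncVal r.1 = truncVal s.1 ∧ zeroInd r.2 = zeroInd s.2 := by
  change (∀ x, x * r = 0 ↔ x * s = 0) ↔ _
  simp only [prod_mul_eq_zero_iff]
  constructor
  · intro h
    have h1 := h (1, 0)
    have h2 := h ((p : ZMod (p ^ 2)), 0)
    have h3 := h (0, 1)
    simp only [truncVal_zero, truncVal_one, truncVal_prime, zeroInd_zero, zeroInd_one] at h1 h2 h3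
    have := truncVal_le r.1
    have := truncVal_le s.1
    have := zeroInd_le r.2
    have := zeroInd_le s.2
    omega
  · rintro ⟨h1, h2⟩ x
    rw [h1, h2]

theorem card_zeroInd_one {R : Type*} [CommRing R] :
    Nat.card {x : R // zeroInd x = 1} = 1 := by
  simp [zeroInd_eq_one]

theorem card_zeroInd_zero : (Nat.card {x : ZMod p // zeroInd x = 0} : ℝ) = p - 1 := by
  have h : ∀ x : ZMod p, zeroInd x = 0 ↔ ¬ x = 0 := fun x => by
    rw [← zeroInd_eq_one]
    have := zeroInd_le x
    omega
  have hp : p.Prime := Fact.out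
  simp only [h, Nat.card_eq_fintype_card, Fintype.card_subtype_compl, ZMod.card,
    Fintype.card_subtype_eq]
  simp [hp.one_le]

theorem card_truncVal_two {R : Type*} [CommRing R] :
    Nat.card {x : R // truncVal x = 2} = 1 := by
  simp [truncVal_eq_two]

theorem card_truncVal_zero :
    (Nat.card {x : ZMod (p ^ 2) // truncVal x = 0} : ℝ) = p * (p - 1) := by
  have hp : p.Prime := Fact.out
  have h : Nat.card {x : ZMod (p ^ 2) // truncVal x = 0} = p * (p - 1) := by
    simp only [truncVal_eq_zero]
    have e : {x : ZMod (p ^ 2) // IsUnit x} ≃ (ZMod (p ^ 2))ˣ :=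
      (Equiv.ofInjective _ Units.val_injective).symm
    rw [Nat.card_congr e, Nat.card_eq_fintype_card, ZMod.card_units_eq_totient,
      Nat.totient_prime_pow hp two_pos]
    simp
  rw [h, Nat.cast_mul, Nat.cast_pred hp.pos]

theorem card_truncVal_one :
    (Nat.card {x : ZMod (p ^ 2) // truncVal x = 1} : ℝ) = p - 1 := by
  have h : Nat.card {x : ZMod (p ^ 2) // truncVal x = 0}
      + Nat.card {x : ZMod (p ^ 2) // truncVal x = 1}
      + Nat.card {x : ZMod (p ^ 2) // truncVal x = 2} = p ^ 2 := by
    classical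
    simp only [Nat.card_eq_fintype_card, Fintype.card_subtype]
    have key := Finset.card_eq_sum_card_fiberwise (s := (Finset.univ : Finset (ZMod (p ^ 2))))
      (f := truncVal) (t := Finset.range 3) fun x _ => by
        simpa [Nat.lt_succ_iff] using truncVal_le x
    rw [Finset.card_univ, ZMod.card] at key
    simp only [key, Finset.sum_range_succ, Finset.sum_range_zero, zero_add]
  rw [card_truncVal_two] at h
  have h' := congrArg (Nat.cast : ℕ → ℝ) h
  push_cast at h'
  rw [card_truncVal_zero] at h'
  linarith

theorem card_annSetoid_class (r : ZMod (p ^ 2) × ZMod p) :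
    Nat.card {s // (annSetoid (ZMod (p ^ 2) × ZMod p)).r r s} =
      Nat.card {x : ZMod (p ^ 2) // truncVal x = truncVal r.1}
        * Nat.card {y : ZMod p // zeroInd y = zeroInd r.2} := by
  rw [← Nat.card_prod]
  refine Nat.card_congr ((Equiv.subtypeEquivRight fun s => ?_).trans
    (Equiv.subtypeProdEquivProd (p := fun x => truncVal x = truncVal r.1)
      (q := fun y => zeroInd y = zeroInd r.2)))
  rw [annSetoid_rel_iff, eq_comm, @eq_comm _ (zeroInd r.2)]

end

theorem qcharpoly_eq_charpoly_submatrix {Q n : Type*} [Finite Q] [Fintype n] [DecidableEq n]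
    (M : Matrix Q Q ℝ) (e : n ≃ Q) : qcharpoly M = (M.submatrix e e).charpoly := by
  unfold qcharpoly
  let _ := Classical.decEq Q
  let _ := Fintype.ofFinite Q
  exact (Matrix.charpoly_reindex e.symm M).symm

/-- Pairs `(truncVal x.1, zeroInd x.2)` attained by the nonzero zero-divisors `x` of
`ZMod (p ^ 2) × ZMod p`. -/
def zeroDivType : Fin 4 → ℕ × ℕ := ![(0, 1), (1, 0), (1, 1), (2, 0)]

/-- A nonzero zero-divisor of each type. -/
def zeroDivRep (p : ℕ) : Fin 4 → ZMod (p ^ 2) × ZMod p :=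
  ![(1, 0), ((p : ZMod (p ^ 2)), 1), ((p : ZMod (p ^ 2)), 0), (0, 1)]

/-- The adjacency matrix of the compressed zero-divisor graph. -/
def compressedAdj : Matrix (Fin 4) (Fin 4) ℝ :=
  !![0, 0, 0, 1; 0, 0, 1, 0; 0, 1, 1, 1; 1, 0, 1, 0]

section

variable {p : ℕ} [Fact p.Prime]

theorem zeroDivRep_type (i : Fin 4) :
    (truncVal (zeroDivRep p i).1, zeroInd (zeroDivRep p i).2) = zeroDivType i := by
  fin_cases i <;>
  simp [zeroDivRep, zeroDivType, truncVal_zero, truncVal_one, truncVal_prime, zeroInd_zero,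
    zeroInd_one]

theorem isZeroDiv_iff (x : ZMod (p ^ 2) × ZMod p) :
    (x ≠ 0 ∧ ∃ y, y ≠ 0 ∧ x * y = 0) ↔ ∃ i, (truncVal x.1, zeroInd x.2) = zeroDivType i := by
  have h0 : ∀ x : ZMod (p ^ 2) × ZMod p, x = 0 ↔ truncVal x.1 = 2 ∧ zeroInd x.2 = 1 :=
    fun x => by rw [truncVal_eq_two, zeroInd_eq_one, Prod.ext_iff]; rfl
  have a1 := truncVal_le x.1
  have a2 := zeroInd_le x.2
  have ht : (∃ i, (truncVal x.1, zeroInd x.2) = zeroDivType i) ↔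
      truncVal x.1 = 0 ∧ zeroInd x.2 = 1 ∨ truncVal x.1 = 1 ∧ zeroInd x.2 = 0 ∨
        truncVal x.1 = 1 ∧ zeroInd x.2 = 1 ∨ truncVal x.1 = 2 ∧ zeroInd x.2 = 0 := by
    simp [Fin.exists_fin_succ, zeroDivType]
  rw [ht, Ne, h0]
  constructor
  · rintro ⟨h, y, hy, hxy⟩
    rw [Ne, h0] at hy
    rw [prod_mul_eq_zero_iff] at hxy
    have := truncVal_le y.1
    have := zeroInd_le y.2
    omega
  · intro h
    refine ⟨by omega, ?_⟩
    by_cases h3 : zeroInd x.2 = 1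
    · refine ⟨(0, 1), ?_, ?_⟩
      · rw [Ne, h0]
        simp [zeroInd_one]
      · rw [prod_mul_eq_zero_iff]
        simp [truncVal_zero, h3]
    · refine ⟨((p : ZMod (p ^ 2)), 0), ?_, ?_⟩
      · rw [Ne, h0]
        simp [truncVal_prime]
      · rw [prod_mul_eq_zero_iff]
        simp only [truncVal_prime, zeroInd_zero]
        omega

theorem ite_mul_eq_zero_eq_compressedAdj {x y : ZMod (p ^ 2) × ZMod p} {i j : Fin 4}
    (hx : (truncVal x.1, zeroInd x.2) = zeroDivType i)
    (hy : (truncVal y.1, zeroInd y.2) = zeroDivType j) :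
    (if x * y = 0 then (1 : ℝ) else 0) = compressedAdj i j := by
  obtain ⟨hx1, hx2⟩ := Prod.ext_iff.1 hx
  obtain ⟨hy1, hy2⟩ := Prod.ext_iff.1 hy
  simp only at hx1 hx2 hy1 hy2
  simp only [prod_mul_eq_zero_iff, hx1, hx2, hy1, hy2]
  fin_cases i <;> fin_cases j <;> simp [zeroDivType, compressedAdj]

end

theorem zeroDivType_injective : Function.Injective zeroDivType := by decide

theorem rank_compressedAdj : compressedAdj.rank = 4 := by
  have h : IsUnit compressedAdj := by
    rw [Matrix.isUnit_iff_isUnit_det]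
    simp [compressedAdj, Matrix.det_succ_row_zero, Fin.sum_univ_succ, Fin.succAbove]
  simpa using Matrix.rank_of_isUnit _ h

open Polynomial in
/-- For a prime `p`, the characteristic polynomial of the weighted
compressed adjacency matrix of `Γ(ℤ_{p²} × ℤ_p)` equals
`(p−1)⁵p + (p−1)³p·x − 2(p−1)²p·x² − (p−1)x³ + x⁴`; in particular `Γ(ℤ_{p²} × ℤ_p)` has
exactly 4 nonzero eigenvalues counted with multiplicity. -/
theorem stmt19 (p : ℕ) [Fact p.Prime] :
    let R := ZMod (p ^ 2) × ZMod p
    let V := {x : R // x ≠ 0 ∧ ∃ y, y ≠ 0 ∧ x * y = 0}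
    let A : Matrix V V ℝ := fun x y => if x.1 * y.1 = 0 then 1 else 0
    let Q := Quotient ((annSetoid R).comap (Subtype.val : V → R))
    -- weighted compressed adjacency matrix: entry `(i,j)` is `#[j]_R` if the classes
    -- are adjacent (product of representatives is `0`) and `0` otherwise
    let W : Matrix Q Q ℝ := fun i j =>
      if (Quotient.out i).1 * (Quotient.out j).1 = 0 then
        (Nat.card {s : R // (annSetoid R).r (Quotient.out j).1 s} : ℝ)
      else 0
    let P : ℝ := (p : ℝ)
    qcharpoly W = C ((P - 1) ^ 5 * P) + C ((P - 1) ^ 3 * P) * X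
        - C (2 * (P - 1) ^ 2 * P) * X ^ 2 - C (P - 1) * X ^ 3 + X ^ 4 ∧
    A.rank = 4 := by
  intro R V A Q W P
  choose f hf using fun x : V => (isZeroDiv_iff x.1).1 x.2
  let g : Fin 4 → V := fun i => ⟨zeroDivRep p i, (isZeroDiv_iff _).2 ⟨i, zeroDivRep_type i⟩⟩
  have hfg : ∀ i, f (g i) = i := fun i =>
    zeroDivType_injective ((hf (g i)).symm.trans (zeroDivRep_type i))
  have hrel : ∀ x y : V, (annSetoid R).r x.1 y.1 ↔ f x = f y := fun x y => by
    rw [annSetoid_rel_iff, ← Prod.mk.injEq, hf, hf, zeroDivType_injective.eq_iff]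
  have hA : ∀ x y : V, (if x.1 * y.1 = 0 then (1 : ℝ) else 0) = compressedAdj (f x) (f y) :=
    fun x y => ite_mul_eq_zero_eq_compressedAdj (hf x) (hf y)
  refine ⟨?_, ?_⟩
  · let e : Fin 4 ≃ Q := Equiv.ofBijective (fun i => Quotient.mk _ (g i)) <| by
      refine ⟨fun i j h => ?_, fun q => ?_⟩
      · simpa only [hfg] using (hrel (g i) (g j)).1
          (Quotient.exact (s := (annSetoid R).comap (Subtype.val : V → R)) h)
      · induction q using Quotient.inductionOn with
        | h x => exact ⟨f x, Quotient.sound ((hrel _ _).2 (hfg _))⟩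
    have he : ∀ i, f (Quotient.out (e i)) = i := fun i => by
      have := (hrel _ _).1 (Quotient.mk_out (s := (annSetoid R).comap (Subtype.val : V → R)) (g i))
      rwa [hfg] at this
    let w : Fin 4 → ℝ := ![P * (P - 1), (P - 1) ^ 2, P - 1, P - 1]
    have hw : ∀ x : V, (Nat.card {s : R // (annSetoid R).r x.1 s} : ℝ) = w (f x) := fun x => by
      rw [card_annSetoid_class]
      obtain ⟨h1, h2⟩ := Prod.ext_iff.1 (hf x)
      simp only at h1 h2
      rw [h1, h2]
      generalize f x = i
      push_cast
      fin_cases i <;>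
      simp [-Nat.card_eq_fintype_card, zeroDivType, w, P, card_zeroInd_one, card_zeroInd_zero, card_truncVal_two,
        card_truncVal_one, card_truncVal_zero, sq]
    have hW : W.submatrix e e = Matrix.of fun i j => compressedAdj i j * w j := by
      ext i j
      have h1 := hA (Quotient.out (e i)) (Quotient.out (e j))
      have h2 := hw (Quotient.out (e j))
      rw [he] at h2
      rw [he, he] at h1
      rw [Matrix.of_apply, ← h1, ← h2, ite_mul, one_mul, zero_mul]
      rfl
    rw [qcharpoly_eq_charpoly_submatrix W e, hW]
    simp [Matrix.charpoly, Matrix.det_succ_row_zero, Fin.sum_univ_succ, Fin.succAbove,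
      Matrix.charmatrix_apply, compressedAdj, w, show (C 2 : ℝ[X]) = 2 from rfl]
    ring
  · have h1 : A = compressedAdj.submatrix f f := by
      ext x y
      exact hA x y
    have h2 : compressedAdj = A.submatrix g g := by
      ext i j
      simp [h1, hfg]
    refine le_antisymm ?_ ?_
    · rw [h1]
      exact (Matrix.rank_submatrix_le _ _ _).trans rank_compressedAdj.le
    · refine rank_compressedAdj.symm.le.trans ?_
      rw [h2]
      exact Matrix.rank_submatrix_le _ _ _
end
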